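/- A cylindrical king permutation σ ∈ CK_n is k-prolific in CK_n (every (n−k)-subset of its entries forms a unique pattern, and all such patterns lie in CK_{n−k}) if and only if cbr(σ) ≥ k + 3. -/

import Mathlib

open Finset

/-- Manhattan distance between the plot points `i` and `j` of `σ`. -/
def mdist {n : ℕ} (σ : Fin n → Fin n) (i j : Fin n) : ℕ :=
  Nat.dist (i : ℕ) (j : ℕ) + Nat.dist (σ i : ℕ) (σ j : ℕ)

/-- The breadth of `σ`: minimum Manhattan distance over distinct pairs (⊤ if no pairs). -/
noncomputable def br {n : ℕ} (σ : Fin n → Fin n) : ℕ∞ :=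
  sInf {x : ℕ∞ | ∃ i j : Fin n, i ≠ j ∧ x = (mdist σ i j : ℕ∞)}

/-- Cyclic Manhattan distance: `|σ j - σ i| + min (|j-i|) (n - |j-i|)`. -/
def cdist {n : ℕ} (σ : Fin n → Fin n) (i j : Fin n) : ℕ :=
  Nat.dist (σ i : ℕ) (σ j : ℕ) +
    min (Nat.dist (i : ℕ) (j : ℕ)) (n - Nat.dist (i : ℕ) (j : ℕ))

/-- Cyclic breadth of `σ`. -/
noncomputable def cbr {n : ℕ} (σ : Fin n → Fin n) : ℕ∞ :=
  sInf {x : ℕ∞ | ∃ i j : Fin n, i ≠ j ∧ x = (cdist σ i j : ℕ∞)}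

/-- King permutation: consecutive entries differ by more than 1. -/
def IsKing {n : ℕ} (σ : Fin n → Fin n) : Prop :=
  ∀ i j : Fin n, (j : ℕ) = (i : ℕ) + 1 → 1 < Nat.dist (σ i : ℕ) (σ j : ℕ)

/-- Cylindrical king permutation: cyclically consecutive entries differ by more than 1. -/
def IsCylKing {n : ℕ} (σ : Fin n → Fin n) : Prop :=
  ∀ i j : Fin n, i ≠ j → (j : ℕ) = ((i : ℕ) + 1) % n →
    1 < Nat.dist (σ i : ℕ) (σ j : ℕ)

/-- `π` is the (standardized) pattern formed by the entries of `σ` at the index set `s`. -/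
def IsPatternOn {n m : ℕ} (σ : Fin n → Fin n) (s : Finset (Fin n))
    (π : Fin m → Fin m) : Prop :=
  ∃ f : Fin m → Fin n, StrictMono f ∧ (∀ a, f a ∈ s) ∧ s.card = m ∧
    ∀ a b, (π a < π b ↔ σ (f a) < σ (f b))

/-- `σ` contains the pattern `π` (classical pattern containment). -/
def ContainsPat {n m : ℕ} (σ : Fin n → Fin n) (π : Fin m → Fin m) : Prop :=
  ∃ f : Fin m → Fin n, StrictMono f ∧ ∀ a b, (π a < π b ↔ σ (f a) < σ (f b))

/-- `σ` is `k`-prolific in `CK_n`: every `(n-k)`-subset of its entries forms a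
cylindrical king pattern, and distinct subsets form distinct patterns. -/
def KProlificCylKing {n : ℕ} (σ : Fin n → Fin n) (k : ℕ) : Prop :=
  (∀ (s : Finset (Fin n)) (π : Fin (n - k) → Fin (n - k)),
      s.card = n - k → IsPatternOn σ s π → IsCylKing π) ∧
  ∀ (s t : Finset (Fin n)) (π : Fin (n - k) → Fin (n - k)),
      s.card = n - k → t.card = n - k →
      IsPatternOn σ s π → IsPatternOn σ t π → s = t

/-- Two families of points are in the same relative order with respect to `X`. -/
def SameOrder {α β ι : Type*} [LT β] (X : α → β) (f g : ι → α) : Prop :=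
  ∀ a b, X (f a) < X (f b) ↔ X (g a) < X (g b)

/-- The correspondence `f a ↦ g a` between two families of points, as a relation. -/
def Transfer {α ι : Type*} (f g : ι → α) (p q : α) : Prop :=
  ∃ a, f a = p ∧ g a = q

section Transfer

variable {α β γ ι : Type*} [LinearOrder β] [LinearOrder γ] {X : α → β} {Y : α → γ} {f g : ι → α}

theorem Transfer.rightUnique (hf : Function.Injective f) :
    Relator.RightUnique (Transfer f g) := by
  rintro _ _ _ ⟨a, rfl, rfl⟩ ⟨b, hb, rfl⟩
  rw [hf hb]

theorem Transfer.le_of_reach (hX : SameOrder X f g) {p q r : α} (hpq : Transfer f g p q)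
    (hlt : X p < X q) (h : Relation.ReflTransGen (Transfer f g) q r) : X q ≤ X r := by
  induction h using Relation.ReflTransGen.head_induction_on generalizing p with
  | refl => exact le_rfl
  | head hs _ ih =>
    obtain ⟨a, rfl, rfl⟩ := hpq
    obtain ⟨b, hb, rfl⟩ := hs
    have hlt' : X (g a) < X (g b) := by
      rw [← hX, hb]
      exact hlt
    exact hlt'.le.trans (ih ⟨b, hb, rfl⟩ hlt')

theorem Transfer.lt_iff_of_reach (hX : SameOrder X f g) {p q p' q' : α}
    (hpq : Transfer f g p q) (h : Relation.ReflTransGen (Transfer f g) q p')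
    (hpq' : Transfer f g p' q') : X p < X q ↔ X p' < X q' := by
  induction h using Relation.ReflTransGen.head_induction_on generalizing p with
  | refl =>
    obtain ⟨a, rfl, rfl⟩ := hpq
    obtain ⟨b, hb, rfl⟩ := hpq'
    rw [← hX, hb]
  | head hs _ ih =>
    rw [← ih hs]
    obtain ⟨a, rfl, rfl⟩ := hpq
    obtain ⟨b, hb, rfl⟩ := hs
    rw [← hX, hb]

theorem Transfer.lt_of_mem_gap (hX : SameOrder X f g) {a : ι} {r r' : α}
    (hr : X (f a) < X r) (h : Transfer f g r r') : X (g a) < X r' := by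
  obtain ⟨c, rfl, rfl⟩ := h
  exact (hX _ _).1 hr

theorem Transfer.source_lt_of_mem_gap (hX : SameOrder X f g) {a : ι} {r r' : α}
    (hr : X r < X (g a)) (h : Transfer f g r' r) : X r' < X (f a) := by
  obtain ⟨c, rfl, rfl⟩ := h
  exact (hX _ _).2 hr

/-- A chain meets the gap between `f a` and `g a` at most once. -/
theorem Transfer.eq_of_reach_of_mem_gap (hX : SameOrder X f g) {a : ι} {r s : α}
    (hr : X (f a) < X r) (hr' : X r < X (g a)) (hs : X s < X (g a))
    (h : Relation.ReflTransGen (Transfer f g) r s) : r = s := by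
  rcases h.cases_head with h | ⟨t, hrt, hts⟩
  · exact h
  · have h1 := lt_of_mem_gap hX hr hrt
    exact absurd (h1.trans_le (le_of_reach hX hrt (hr'.trans h1) hts)) hs.not_gt

/-- A chain leading from the `X`-gap of `a` to a different point in the `Y`-gap of `b` increases
both coordinates. -/
theorem Transfer.increasing_of_reach (hX : SameOrder X f g) (hY : SameOrder Y f g) {a b : ι}
    {r s : α} (hr : X (f a) < X r) (hr' : X r < X (g a)) (hs : Y (f b) < Y s)
    (hs' : Y s < Y (g b)) (hne : r ≠ s) (h : Relation.ReflTransGen (Transfer f g) r s) :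
    ∃ c, f c = r ∧ X (f c) < X (g c) ∧ Y (f c) < Y (g c) ∧ X (g c) ≤ X s ∧ Y (g c) ≤ Y s := by
  rcases h.cases_head with h | ⟨t, hrt, hts⟩
  · exact absurd h hne
  have hXrt : X r < X t := hr'.trans (lt_of_mem_gap hX hr hrt)
  have hYrt : Y r < Y t := by
    rcases hts.cases_tail with rfl | ⟨u, htu, hus⟩
    · exact (source_lt_of_mem_gap hY hs' hrt).trans hs
    · exact (lt_iff_of_reach hY hrt htu hus).2 ((source_lt_of_mem_gap hY hs' hus).trans hs)
  obtain ⟨c, rfl, rfl⟩ := id hrt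
  exact ⟨c, rfl, hXrt, hYrt, le_of_reach hX hrt hXrt hts, le_of_reach hY hrt hYrt hts⟩

/-- Every point that is not fixed by the transfer is reached from a point outside the target. -/
theorem Transfer.exists_root [WellFoundedLT β] [WellFoundedGT β] (hX : SameOrder X f g)
    (hinj : Function.Injective X) (q : α) (hq : ∀ a, f a = q → g a ≠ q) :
    ∃ e, (∀ a, g a ≠ e) ∧ Relation.ReflTransGen (Transfer f g) e q := by
  have up : ∀ x : β, ∀ a, X (g a) = x → X (f a) < X (g a) →
      ∃ e, (∀ b, g b ≠ e) ∧ Relation.ReflTransGen (Transfer f g) e (g a) := by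
    intro x
    induction x using WellFoundedLT.induction with
    | ind x ih =>
      rintro a rfl hlt
      by_cases hb : ∃ b, g b = f a
      · obtain ⟨b, hb⟩ := hb
        have hlt' : X (f b) < X (g b) := by
          rw [hb, hX, hb]
          exact hlt
        obtain ⟨e, he, hreach⟩ := ih (X (g b)) (hb ▸ hlt) b rfl hlt'
        exact ⟨e, he, hreach.tail ⟨a, hb.symm, rfl⟩⟩
      · exact ⟨f a, fun b h => hb ⟨b, h⟩, .single ⟨a, rfl, rfl⟩⟩
  have down : ∀ x : β, ∀ a, X (g a) = x → X (g a) < X (f a) →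
      ∃ e, (∀ b, g b ≠ e) ∧ Relation.ReflTransGen (Transfer f g) e (g a) := by
    intro x
    induction x using WellFoundedGT.induction with
    | ind x ih =>
      rintro a rfl hlt
      by_cases hb : ∃ b, g b = f a
      · obtain ⟨b, hb⟩ := hb
        have hlt' : X (g b) < X (f b) := by
          rw [hb, hX, hb]
          exact hlt
        obtain ⟨e, he, hreach⟩ := ih (X (g b)) (hb ▸ hlt) b rfl hlt'
        exact ⟨e, he, hreach.tail ⟨a, hb.symm, rfl⟩⟩
      · exact ⟨f a, fun b h => hb ⟨b, h⟩, .single ⟨a, rfl, rfl⟩⟩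
  by_cases h : ∃ a, g a = q
  · obtain ⟨a, rfl⟩ := h
    rcases lt_trichotomy (X (f a)) (X (g a)) with h | h | h
    · exact up _ a rfl h
    · exact absurd rfl (hq a (hinj h))
    · exact down _ a rfl h
  · exact ⟨q, fun a h' => h ⟨a, h'⟩, .refl⟩

end Transfer

section Close

variable {α ι : Type*} [Fintype α] [Fintype ι] {n k : ℕ} {f g : ι → α}

theorem card_filter_between (X : α ≃ Fin n) (p q : α) :
    #{r | X p < X r ∧ X r < X q} = (X q : ℕ) - X p - 1 := by
  rw [← Fin.card_Ioo, ← Finset.card_map X.symm.toEmbedding]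
  congr 1
  ext r
  simp only [mem_filter, mem_univ, true_and, mem_map, mem_Ioo]
  constructor
  · exact fun h => ⟨X r, h, by simp⟩
  · rintro ⟨x, hx, rfl⟩
    simpa using hx

/-- The number of points in two gaps that no chain meets twice is at most `k`, so that the
endpoints are close. -/
theorem exists_close_of_gaps (X Y : α ≃ Fin n) (hf : Function.Injective f)
    (hg : Function.Injective g) (hX : SameOrder X f g) (hY : SameOrder Y f g)
    (hcard : Fintype.card α = Fintype.card ι + k) {p q p' q' : α}
    (hends : p' = p ∧ q' = q ∨ p' = q ∧ q' = p) (hpq : X p < X q) (hpq' : Y p' < Y q') {a b : ι}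
    (hXa : X (f a) ≤ X p) (hXa' : X q ≤ X (g a)) (hYb : Y (f b) ≤ Y p') (hYb' : Y q' ≤ Y (g b))
    (hlow : ∀ c, X (f c) < X (g c) → Y (f c) < Y (g c) → X (f c) < X q → ¬ Y (f c) < Y p')
    (hleft : ∀ c, X (f c) < X (g c) → Y (f c) < Y (g c) → Y (f c) < Y q' → ¬ X (f c) < X p) :
    ∃ r s, r ≠ s ∧ Nat.dist (X r) (X s) + Nat.dist (Y r) (Y s) ≤ k + 2 := by
  classical
  by_contra! hfar
  set A : Finset α := {r | X p < X r ∧ X r < X q} with hA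
  set B : Finset α := {r | Y p' < Y r ∧ Y r < Y q'} with hB
  set E : Finset α := (univ.image g)ᶜ with hE
  have hEcard : #E = k := by
    rw [hE, card_compl, card_image_of_injective _ hg, card_univ, hcard]
    omega
  choose! root hroot hreach using Transfer.exists_root hX X.injective
  have hnfA : ∀ r ∈ A, ∀ c, f c = r → g c ≠ r := by
    rintro r hr c rfl hc
    simp only [hA, mem_filter, mem_univ, true_and] at hr
    have := (hX a c).1 (hXa.trans_lt hr.1)
    rw [hc] at this
    exact absurd (hr.2.trans_le hXa') this.not_gt
  have hnfB : ∀ r ∈ B, ∀ c, f c = r → g c ≠ r := by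
    rintro r hr c rfl hc
    simp only [hB, mem_filter, mem_univ, true_and] at hr
    have := (hY b c).1 (hYb.trans_lt hr.1)
    rw [hc] at this
    exact absurd (hr.2.trans_le hYb') this.not_gt
  have comparable : ∀ r s, (∀ c, f c = r → g c ≠ r) → (∀ c, f c = s → g c ≠ s) →
      root r = root s → Relation.ReflTransGen (Transfer f g) r s ∨
        Relation.ReflTransGen (Transfer f g) s r := by
    intro r s hr hs h
    have h' := hreach s hs
    rw [← h] at h'
    exact Relation.ReflTransGen.total_of_right_unique (Transfer.rightUnique hf) (hreach r hr) h'
  have uniqA : ∀ r ∈ A, ∀ s ∈ A, Relation.ReflTransGen (Transfer f g) r s → r = s := by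
    intro r hr s hs
    simp only [hA, mem_filter, mem_univ, true_and] at hr hs
    exact Transfer.eq_of_reach_of_mem_gap hX (hXa.trans_lt hr.1) (hr.2.trans_le hXa')
      (hs.2.trans_le hXa')
  have uniqB : ∀ r ∈ B, ∀ s ∈ B, Relation.ReflTransGen (Transfer f g) r s → r = s := by
    intro r hr s hs
    simp only [hB, mem_filter, mem_univ, true_and] at hr hs
    exact Transfer.eq_of_reach_of_mem_gap hY (hYb.trans_lt hr.1) (hr.2.trans_le hYb')
      (hs.2.trans_le hYb')
  have injA : Set.InjOn root A := by
    intro r hr s hs h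
    rcases comparable r s (hnfA r hr) (hnfA s hs) h with h | h
    · exact uniqA r hr s hs h
    · exact (uniqA s hs r hr h).symm
  have injB : Set.InjOn root B := by
    intro r hr s hs h
    rcases comparable r s (hnfB r hr) (hnfB s hs) h with h | h
    · exact uniqB r hr s hs h
    · exact (uniqB s hs r hr h).symm
  have subA : A.image root ⊆ E := by
    intro e he
    obtain ⟨r, hr, rfl⟩ := mem_image.1 he
    simpa [hE] using hroot r (hnfA r hr)
  have subB : B.image root ⊆ E := by
    intro e he
    obtain ⟨r, hr, rfl⟩ := mem_image.1 he
    simpa [hE] using hroot r (hnfB r hr)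
  have cardA := card_filter_between X p q
  have cardB := card_filter_between Y p' q'
  rw [← hA] at cardA
  rw [← hB] at cardB
  have leA : #A ≤ k := by
    rw [← card_image_of_injOn injA, ← hEcard]
    exact card_le_card subA
  have leB : #B ≤ k := by
    rw [← card_image_of_injOn injB, ← hEcard]
    exact card_le_card subB
  have hne : p ≠ q := fun h => hpq.ne (by rw [h])
  have hdistY : Nat.dist (Y p) (Y q) = (Y q' : ℕ) - Y p' := by
    rcases hends with ⟨rfl, rfl⟩ | ⟨rfl, rfl⟩ <;> simp only [Nat.dist] <;> omega
  have not_both : ∀ r ∈ A, r ∉ B := by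
    intro r hr hr'
    simp only [hA, mem_filter, mem_univ, true_and] at hr
    simp only [hB, mem_filter, mem_univ, true_and] at hr'
    have h1 := hfar p r fun h => hr.1.ne (by rw [h])
    have h2 := hfar r q fun h => hr.2.ne (by rw [h])
    rcases hends with ⟨rfl, rfl⟩ | ⟨rfl, rfl⟩ <;> simp only [Nat.dist] at h1 h2 <;> omega
  have disj : Disjoint (A.image root) (B.image root) := by
    rw [disjoint_left]
    intro e he he'
    obtain ⟨r, hr, rfl⟩ := mem_image.1 he
    obtain ⟨s, hs, h⟩ := mem_image.1 he'
    have hrs : r ≠ s := fun h' => not_both r hr (h' ▸ hs)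
    have hrA := hr
    have hsB := hs
    simp only [hA, mem_filter, mem_univ, true_and] at hrA
    simp only [hB, mem_filter, mem_univ, true_and] at hsB
    rcases comparable r s (hnfA r hr) (hnfB s hs) h.symm with h | h
    · obtain ⟨c, rfl, hc1, hc2, hc3, hc4⟩ := Transfer.increasing_of_reach hX hY
        (hXa.trans_lt hrA.1) (hrA.2.trans_le hXa') (hYb.trans_lt hsB.1) (hsB.2.trans_le hYb') hrs h
      refine hlow c hc1 hc2 hrA.2 (lt_of_le_of_ne (not_lt.1 fun h' => ?_) fun h' => ?_)
      · exact not_both _ hr (by simpa [hB] using ⟨h', (hc2.trans_le hc4).trans hsB.2⟩)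
      · rcases hends with ⟨rfl, rfl⟩ | ⟨rfl, rfl⟩ <;> simp [Y.injective h'] at hrA
    · obtain ⟨c, rfl, hc1, hc2, hc3, hc4⟩ := Transfer.increasing_of_reach hY hX
        (hYb.trans_lt hsB.1) (hsB.2.trans_le hYb') (hXa.trans_lt hrA.1) (hrA.2.trans_le hXa')
        hrs.symm h
      refine hleft c hc2 hc1 hsB.2 (lt_of_le_of_ne (not_lt.1 fun h' => ?_) fun h' => ?_)
      · exact not_both _ (by simpa [hA] using ⟨h', (hc2.trans_le hc4).trans hrA.2⟩) hs
      · rcases hends with ⟨rfl, rfl⟩ | ⟨rfl, rfl⟩ <;> simp [X.injective h'] at hsB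
  have total : #A + #B ≤ k := by
    rw [← card_image_of_injOn injA, ← card_image_of_injOn injB, ← card_union_of_disjoint disj,
      ← hEcard]
    exact card_le_card (union_subset subA subB)
  have := hfar p q hne
  rw [hdistY] at this
  simp only [Nat.dist] at this
  omega

/-- If some transferred point moves up and to the right, then some two points are close. -/
theorem exists_close_of_increasing (X Y : α ≃ Fin n) (hf : Function.Injective f)
    (hg : Function.Injective g) (hX : SameOrder X f g) (hY : SameOrder Y f g)
    (hcard : Fintype.card α = Fintype.card ι + k)
    (hinc : ∃ a, X (f a) < X (g a) ∧ Y (f a) < Y (g a)) :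
    ∃ r s, r ≠ s ∧ Nat.dist (X r) (X s) + Nat.dist (Y r) (Y s) ≤ k + 2 := by
  classical
  set N : Finset ι := {a | X (f a) < X (g a) ∧ Y (f a) < Y (g a)} with hN
  have memN : ∀ a, a ∈ N ↔ X (f a) < X (g a) ∧ Y (f a) < Y (g a) := by simp [hN]
  have hNne : N.Nonempty := by
    obtain ⟨a, ha⟩ := hinc
    exact ⟨a, (memN a).2 ha⟩
  set M : Finset ι := {a ∈ N | ∀ c ∈ N, X (f c) < X (g a) → ¬ Y (f c) < Y (f a)} with hM
  have memM : ∀ a, a ∈ M ↔ a ∈ N ∧ ∀ c ∈ N, X (f c) < X (g a) → ¬ Y (f c) < Y (f a) := by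
    simp [hM]
  have hMne : M.Nonempty := by
    obtain ⟨p, hp, hmin⟩ := exists_min_image N (fun a => Y (f a)) hNne
    exact ⟨p, (memM p).2 ⟨hp, fun c hc _ => (hmin c hc).not_gt⟩⟩
  obtain ⟨z, hz, hzmin⟩ := exists_min_image M (fun a => X (f a)) hMne
  obtain ⟨hzN, hzlow⟩ := (memM z).1 hz
  obtain ⟨hzX, hzY⟩ := (memN z).1 hzN
  by_cases hB : ∃ c ∈ N, X (f c) < X (f z) ∧ Y (f c) < Y (g z)
  · obtain ⟨c, hc, hcX, hcY⟩ := hB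
    obtain ⟨u, hu, humin⟩ := exists_min_image {a ∈ N | X (f a) < X (f z)} (fun a => Y (f a))
      ⟨c, by simp [hc, hcX]⟩
    simp only [mem_filter] at hu humin
    have huY : Y (f u) < Y (g z) := (humin c ⟨hc, hcX⟩).trans_lt hcY
    have huM : u ∉ M := fun h => (hzmin u h).not_gt hu.2
    have hzu : X (f z) < X (g u) := by
      rw [memM] at huM
      push Not at huM
      obtain ⟨j, hj, hjX, hjY⟩ := huM hu.1
      refine lt_of_le_of_lt (not_lt.1 fun h => ?_) hjX
      exact (humin j ⟨hj, h⟩).not_gt hjY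
    have hzuY : Y (f z) < Y (f u) := by
      refine lt_of_le_of_ne (not_lt.1 (hzlow u hu.1 (hu.2.trans hzX))) fun h => ?_
      rw [Y.injective h] at hu
      exact lt_irrefl _ hu.2
    refine exists_close_of_gaps X Y hf hg hX hY hcard (p := f u) (q := f z) (p' := f z)
      (q' := f u) (.inr ⟨rfl, rfl⟩) hu.2 hzuY le_rfl hzu.le le_rfl huY.le ?_ ?_
    · exact fun d h1 h2 h3 => hzlow d ((memN d).2 ⟨h1, h2⟩) (h3.trans hzX)
    · exact fun d h1 h2 h3 h4 => (humin d ⟨(memN d).2 ⟨h1, h2⟩, h4.trans hu.2⟩).not_gt h3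
  · push Not at hB
    refine exists_close_of_gaps X Y hf hg hX hY hcard (.inl ⟨rfl, rfl⟩) hzX hzY
      le_rfl le_rfl le_rfl le_rfl ?_ ?_
    · exact fun d h1 h2 => hzlow d ((memN d).2 ⟨h1, h2⟩)
    · exact fun d h1 h2 h3 h4 => (hB d ((memN d).2 ⟨h1, h2⟩) h4).not_gt h3

/-- Two distinct families of all but `k` of the points, in the same relative order horizontally and
vertically, force two points of the set to be close. -/
theorem exists_close_of_sameOrder (X Y : α ≃ Fin n) (hf : Function.Injective f)
    (hg : Function.Injective g) (hX : SameOrder X f g) (hY : SameOrder Y f g)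
    (hcard : Fintype.card α = Fintype.card ι + k) (hne : f ≠ g) :
    ∃ r s, r ≠ s ∧ Nat.dist (X r) (X s) + Nat.dist (Y r) (Y s) ≤ k + 2 := by
  have hrev : ∀ {Z : α ≃ Fin n}, SameOrder Z f g → SameOrder (Z.trans Fin.revPerm) f g := by
    intro Z hZ a b
    simpa using hZ b a
  have hdist : ∀ i j : Fin n, Nat.dist (Fin.rev i) (Fin.rev j) = Nat.dist i j := by
    intro i j
    simp only [Nat.dist, Fin.val_rev]
    omega
  obtain ⟨a, ha⟩ := Function.ne_iff.1 hne
  rcases lt_or_gt_of_ne (X.injective.ne ha) with h1 | h1 <;>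
    rcases lt_or_gt_of_ne (Y.injective.ne ha) with h2 | h2
  · exact exists_close_of_increasing X Y hf hg hX hY hcard ⟨a, h1, h2⟩
  · simpa [hdist, -Fin.val_rev] using
      exists_close_of_increasing X (Y.trans Fin.revPerm) hf hg hX (hrev hY) hcard
        ⟨a, h1, by simpa using h2⟩
  · simpa [hdist, -Fin.val_rev] using
      exists_close_of_increasing (X.trans Fin.revPerm) Y hf hg (hrev hX) hY hcard
        ⟨a, by simpa using h1, h2⟩
  · simpa [hdist, -Fin.val_rev] using
      exists_close_of_increasing (X.trans Fin.revPerm) (Y.trans Fin.revPerm)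
        hf hg (hrev hX) (hrev hY) hcard ⟨a, by simpa using h1, by simpa using h2⟩

end Close

theorem le_cbr_iff {n : ℕ} (σ : Fin n → Fin n) (c : ℕ) :
    (c : ℕ∞) ≤ cbr σ ↔ ∀ i j, i ≠ j → c ≤ cdist σ i j := by
  rw [cbr, le_sInf_iff]
  constructor
  · intro h i j hij
    exact_mod_cast h _ ⟨i, j, hij, rfl⟩
  · rintro h _ ⟨i, j, hij, rfl⟩
    exact_mod_cast h i j hij

theorem cdist_comm {n : ℕ} (σ : Fin n → Fin n) (i j : Fin n) : cdist σ i j = cdist σ j i := by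
  simp only [cdist, Nat.dist_comm]

theorem exists_isPatternOn {n m : ℕ} (σ : Equiv.Perm (Fin n)) (s : Finset (Fin n))
    (hs : s.card = m) : ∃ π : Fin m → Fin m, IsPatternOn σ s π := by
  have ht : (s.map σ.toEmbedding).card = m := by rw [card_map, hs]
  have hmem : ∀ a, σ (s.orderEmbOfFin hs a) ∈ s.map σ.toEmbedding := fun a =>
    mem_map.2 ⟨_, s.orderEmbOfFin_mem hs a, rfl⟩
  refine ⟨fun a => ((s.map σ.toEmbedding).orderIsoOfFin ht).symm ⟨_, hmem a⟩,
    s.orderEmbOfFin hs, (s.orderEmbOfFin hs).strictMono, s.orderEmbOfFin_mem hs, hs, ?_⟩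
  intro a b
  rw [OrderIso.lt_iff_lt, Subtype.mk_lt_mk]

theorem pattern_injective {n m : ℕ} {σ : Equiv.Perm (Fin n)} {f : Fin m → Fin n}
    {π : Fin m → Fin m} (hf : StrictMono f) (hπ : ∀ a b, π a < π b ↔ σ (f a) < σ (f b)) :
    Function.Injective π := by
  intro a b hab
  refine hf.injective (σ.injective (le_antisymm ?_ ?_)) <;>
  · rw [← not_lt, ← hπ, hab]
    exact lt_irrefl _

theorem range_eq_of_mem {n m : ℕ} {s : Finset (Fin n)} {f : Fin m → Fin n} (hf : StrictMono f)
    (hmem : ∀ a, f a ∈ s) (hs : s.card = m) : univ.image f = s := by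
  apply eq_of_subset_of_card_le
  · intro x hx
    obtain ⟨a, -, rfl⟩ := mem_image.1 hx
    exact hmem a
  · rw [card_image_of_injective _ hf.injective, hs, card_univ, Fintype.card_fin]

/-- The number of points lying vertically strictly between `i` and `j`. -/
theorem card_val_between {n : ℕ} (σ : Equiv.Perm (Fin n)) (i j : Fin n) :
    #{r | (σ i < σ r ∧ σ r < σ j) ∨ (σ j < σ r ∧ σ r < σ i)} =
      Nat.dist (σ i) (σ j) - 1 := by
  have hd : Disjoint ({r | σ i < σ r ∧ σ r < σ j} : Finset (Fin n))
      ({r | σ j < σ r ∧ σ r < σ i} : Finset (Fin n)) := by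
    rw [disjoint_left]
    intro r h h'
    simp only [mem_filter, mem_univ, true_and] at h h'
    exact absurd (h.1.trans h.2) (h'.1.trans h'.2).not_gt
  rw [filter_or, card_union_of_disjoint hd, card_filter_between, card_filter_between]
  simp only [Nat.dist]
  omega

theorem card_pos_between {n : ℕ} (i j : Fin n) :
    #{r | i < r ∧ r < j} = (j : ℕ) - i - 1 := by
  rw [← Fin.card_Ioo]
  congr 1
  ext r
  simp

theorem card_pos_outside {n : ℕ} {i j : Fin n} (hij : i ≤ j) :
    #{r | r < i ∨ j < r} = (i : ℕ) + (n - 1 - j) := by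
  have hd : Disjoint ({r | r < i} : Finset (Fin n)) ({r | j < r} : Finset (Fin n)) := by
    rw [disjoint_left]
    intro r h h'
    simp only [mem_filter, mem_univ, true_and] at h h'
    exact absurd (h.trans_le hij) h'.not_gt
  rw [filter_or, card_union_of_disjoint hd, filter_gt_eq_Iio, filter_lt_eq_Ioi, Fin.card_Iio,
    Fin.card_Ioi]

theorem isCylKing_of_isPatternOn {n k : ℕ} {σ : Equiv.Perm (Fin n)} (hkn : k ≤ n)
    (hσ : ∀ i j, i ≠ j → k + 3 ≤ cdist σ i j) {s : Finset (Fin n)} {π : Fin (n - k) → Fin (n - k)}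
    (h : IsPatternOn σ s π) : IsCylKing π := by
  obtain ⟨f, hf, hmem, hs, hπ⟩ := h
  intro i j hij hji
  by_contra! hclose
  set B : Finset (Fin n) :=
    {r | (σ (f i) < σ r ∧ σ r < σ (f j)) ∨ (σ (f j) < σ r ∧ σ r < σ (f i))} with hB
  have cardB := card_val_between σ (f i) (f j)
  rw [← hB] at cardB
  have hBs : B ⊆ sᶜ := by
    intro r hr
    rw [mem_compl, ← range_eq_of_mem hf hmem hs]
    intro hr'
    obtain ⟨c, -, rfl⟩ := mem_image.1 hr'
    simp only [hB, mem_filter, mem_univ, true_and, ← hπ] at hr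
    simp only [Nat.dist] at hclose
    omega
  have hscard : #sᶜ = k := by
    rw [card_compl, hs, Fintype.card_fin]
    omega
  have hfne : f i ≠ f j := hf.injective.ne hij
  have hσne : (σ (f i) : ℕ) ≠ σ (f j) := fun h => hfne (σ.injective (Fin.ext h))
  have key : ∀ A : Finset (Fin n), A ⊆ sᶜ → (∀ r ∈ A, cdist σ (f i) r + cdist σ r (f j) ≤
      #A + 1 + (Nat.dist (σ (f i)) (σ r) + Nat.dist (σ r) (σ (f j)))) →
      cdist σ (f i) (f j) ≤ #A + 1 + Nat.dist (σ (f i)) (σ (f j)) → False := by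
    intro A hAs hA hle
    have hfar := hσ _ _ hfne
    have leA := card_le_card hAs
    have leB := card_le_card hBs
    by_cases hd : Disjoint A B
    · have := card_le_card (union_subset hAs hBs)
      rw [card_union_of_disjoint hd, hscard, cardB] at this
      simp only [Nat.dist] at *
      omega
    · obtain ⟨r, hrA, hrB⟩ := not_disjoint_iff.1 hd
      have hrs : ∀ c, r ≠ f c := fun c hc => (mem_compl.1 (hAs hrA)) (hc ▸ hmem c)
      have h1 := hσ _ _ (hrs i).symm
      have h2 := hσ _ _ (hrs j)
      have h3 := hA r hrA
      simp only [hB, mem_filter, mem_univ, true_and] at hrB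
      have h4 : Nat.dist (σ (f i)) (σ r) + Nat.dist (σ r) (σ (f j)) =
          Nat.dist (σ (f i)) (σ (f j)) := by
        simp only [Nat.dist]
        omega
      rw [h4] at h3
      omega
  have hnm : (i : ℕ) < n - k := i.isLt
  rcases Nat.lt_or_ge ((i : ℕ) + 1) (n - k) with hi | hi
  · rw [Nat.mod_eq_of_lt hi] at hji
    have hlt : f i < f j := hf (by rw [Fin.lt_def]; omega)
    apply key {r | f i < r ∧ r < f j}
    · intro r hr
      rw [mem_compl, ← range_eq_of_mem hf hmem hs]
      intro hr'
      obtain ⟨c, -, rfl⟩ := mem_image.1 hr'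
      simp only [mem_filter, mem_univ, true_and, hf.lt_iff_lt] at hr
      omega
    · intro r hr
      rw [card_pos_between]
      simp only [mem_filter, mem_univ, true_and] at hr
      simp only [cdist, Nat.dist]
      omega
    · rw [card_pos_between]
      simp only [cdist, Nat.dist]
      omega
  · have hi' : (i : ℕ) + 1 = n - k := by omega
    rw [hi', Nat.mod_self] at hji
    have hlt : f j < f i := hf (by
      rw [Fin.lt_def]
      have := Fin.val_ne_of_ne hij
      omega)
    apply key {r | r < f j ∨ f i < r}
    · intro r hr
      rw [mem_compl, ← range_eq_of_mem hf hmem hs]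
      intro hr'
      obtain ⟨c, -, rfl⟩ := mem_image.1 hr'
      simp only [mem_filter, mem_univ, true_and, hf.lt_iff_lt] at hr
      omega
    · intro r hr
      rw [card_pos_outside hlt.le]
      simp only [mem_filter, mem_univ, true_and] at hr
      simp only [cdist, Nat.dist]
      omega
    · rw [card_pos_outside hlt.le]
      simp only [cdist, Nat.dist]
      omega

theorem eq_of_isPatternOn {n k : ℕ} {σ : Equiv.Perm (Fin n)} (hkn : k ≤ n)
    (hσ : ∀ i j, i ≠ j → k + 3 ≤ cdist σ i j) {s t : Finset (Fin n)}
    {π : Fin (n - k) → Fin (n - k)} (hs : IsPatternOn σ s π) (ht : IsPatternOn σ t π) : s = t := by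
  obtain ⟨f, hf, hfs, hscard, hfπ⟩ := hs
  obtain ⟨g, hg, hgt, htcard, hgπ⟩ := ht
  rw [← range_eq_of_mem hf hfs hscard, ← range_eq_of_mem hg hgt htcard]
  by_contra hne
  obtain ⟨r, s, hrs, hle⟩ := exists_close_of_sameOrder (f := f) (g := g) (k := k) (Equiv.refl _) σ
    hf.injective hg.injective (fun a b => by simp [hf.lt_iff_lt, hg.lt_iff_lt])
    (fun a b => by rw [← hfπ, hgπ]) (by simp only [Fintype.card_fin]; omega)
    (fun h => hne (by rw [h]))
  have := hσ r s hrs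
  simp only [cdist, Equiv.refl_apply] at this hle
  omega

/-- A set of points of size `n - k` whose pattern is not cylindrical king, obtained by deleting the
points between two points that are close. -/
theorem exists_not_isCylKing_of_cdist_le {n k : ℕ} (σ : Equiv.Perm (Fin n)) (hkn : k + 2 ≤ n)
    {p q : Fin n} (hpq : p < q) (hle : cdist σ p q ≤ k + 2) :
    ∃ (s : Finset (Fin n)) (π : Fin (n - k) → Fin (n - k)),
      s.card = n - k ∧ IsPatternOn σ s π ∧ ¬ IsCylKing π := by
  set B : Finset (Fin n) :=
    {r | (σ p < σ r ∧ σ r < σ q) ∨ (σ q < σ r ∧ σ r < σ p)} with hB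
  have cardB := card_val_between σ p q
  rw [← hB] at cardB
  have hσne : (σ p : ℕ) ≠ σ q := fun h => hpq.ne (σ.injective (Fin.ext h))
  have key : ∀ A : Finset (Fin n), #A + #B ≤ k → p ∉ A → q ∉ A →
      ∃ (s : Finset (Fin n)) (π : Fin (n - k) → Fin (n - k)) (f : Fin (n - k) → Fin n)
        (a b : Fin (n - k)), s.card = n - k ∧ IsPatternOn σ s π ∧ StrictMono f ∧ f a = p ∧
        f b = q ∧ (∀ c, f c ∉ A) ∧ Nat.dist (π a) (π b) ≤ 1 := by
    intro A hcard hpA hqA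
    have hsub : A ∪ B ⊆ ({p, q} : Finset (Fin n))ᶜ := by
      intro r hr
      simp only [mem_compl, mem_insert, mem_singleton]
      rintro (rfl | rfl) <;> simp [hpA, hqA, hB] at hr
    obtain ⟨D, hD, hD', hDcard⟩ := exists_subsuperset_card_eq hsub
      ((card_union_le A B).trans hcard) (by
        rw [card_compl, card_pair hpq.ne, Fintype.card_fin]
        omega)
    have hscard : #Dᶜ = n - k := by rw [card_compl, hDcard, Fintype.card_fin]
    obtain ⟨π, f, hf, hmem, hs, hπ⟩ := exists_isPatternOn σ Dᶜ hscard
    have hrange := range_eq_of_mem hf hmem hs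
    have mem_range : ∀ r, r ∉ D → ∃ c, f c = r := by
      intro r hr
      rw [← mem_compl, ← hrange] at hr
      simpa using hr
    obtain ⟨a, ha⟩ := mem_range p fun h => by simpa using hD' h
    obtain ⟨b, hb⟩ := mem_range q fun h => by simpa using hD' h
    refine ⟨Dᶜ, π, f, a, b, hscard, ⟨f, hf, hmem, hs, hπ⟩, hf, ha, hb, ?_, ?_⟩
    · exact fun c hc => (mem_compl.1 (hmem c)) (hD (mem_union_left _ hc))
    · have hnot : ∀ x, ¬ ((π a < x ∧ x < π b) ∨ (π b < x ∧ x < π a)) := by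
        intro x hx
        obtain ⟨c, rfl⟩ := Finite.surjective_of_injective (pattern_injective hf hπ) x
        rw [hπ, hπ, hπ, hπ, ha, hb] at hx
        exact (mem_compl.1 (hmem c)) (hD (mem_union_right _ (by simpa [hB] using hx)))
      by_contra! hlt
      simp only [Nat.dist] at hlt
      rcases Nat.lt_or_ge (π a) (π b) with h | h
      · exact hnot ⟨π a + 1, by omega⟩ (.inl ⟨by simp [Fin.lt_def], by simp [Fin.lt_def]; omega⟩)
      · exact hnot ⟨π b + 1, by omega⟩ (.inr ⟨by simp [Fin.lt_def], by simp [Fin.lt_def]; omega⟩)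
  rcases Nat.le_total (Nat.dist (p : ℕ) q) (n - Nat.dist (p : ℕ) q) with hd | hd
  · obtain ⟨s, π, f, a, b, hs, hpat, hf, rfl, rfl, hA, hclose⟩ := key {r | p < r ∧ r < q} (by
      rw [card_pos_between, cardB]
      rw [cdist, min_eq_left hd] at hle
      simp only [Nat.dist] at *
      omega) (by simp) (by simp)
    simp only [mem_filter, mem_univ, true_and, hf.lt_iff_lt] at hA
    rw [hf.lt_iff_lt] at hpq
    refine ⟨s, π, hs, hpat, fun hK => (hK a b hpq.ne ?_).not_ge hclose⟩
    have hb : ¬ (a : ℕ) + 1 < b := fun h => hA ⟨a + 1, by omega⟩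
      ⟨by simp [Fin.lt_def], by simpa [Fin.lt_def] using h⟩
    rw [Nat.mod_eq_of_lt (by omega)]
    omega
  · obtain ⟨s, π, f, a, b, hs, hpat, hf, rfl, rfl, hA, hclose⟩ := key {r | r < p ∨ q < r} (by
      rw [card_pos_outside hpq.le, cardB]
      rw [cdist, min_eq_right hd] at hle
      simp only [Nat.dist] at *
      omega) (by simpa using hpq.le) (by simpa using hpq.le)
    simp only [mem_filter, mem_univ, true_and, hf.lt_iff_lt] at hA
    rw [hf.lt_iff_lt] at hpq
    refine ⟨s, π, hs, hpat, fun hK =>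
      (hK b a hpq.ne' ?_).not_ge (by rwa [Nat.dist_comm])⟩
    have ha := hA ⟨0, by omega⟩
    have hb := hA ⟨n - k - 1, by omega⟩
    simp only [Fin.lt_def] at ha hb
    have hb' : (b : ℕ) + 1 = n - k := by omega
    rw [hb', Nat.mod_self]
    omega

theorem stmt_9 (n k : ℕ) (hk : 1 ≤ k) (hkn : k ≤ n - 1)
    (σ : Equiv.Perm (Fin n)) (hσ : IsCylKing ⇑σ) :
    KProlificCylKing ⇑σ k ↔ (k + 3 : ℕ∞) ≤ cbr ⇑σ := by
  have hiff := le_cbr_iff σ (k + 3)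
  push_cast at hiff
  rw [hiff]
  constructor
  · rintro ⟨hking, hdistinct⟩
    rcases Nat.lt_or_ge n (k + 2) with hn | hn
    · have hm : n - k = 1 := by omega
      have hsingle : ∀ x : Fin n, IsPatternOn σ {x} (id : Fin (n - k) → Fin (n - k)) := by
        intro x
        have hsub : Subsingleton (Fin (n - k)) := by
          rw [hm]
          infer_instance
        refine ⟨fun _ => x, fun a b hab => absurd (Subsingleton.elim a b) hab.ne, by simp,
          by simp [hm], fun a b => ?_⟩
        simp [Subsingleton.elim a b]
      have h01 := hdistinct {⟨0, by omega⟩} {⟨1, by omega⟩} id (by simp [hm]) (by simp [hm])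
        (hsingle _) (hsingle _)
      simp at h01
    · by_contra! hclose
      obtain ⟨i, j, hij, hlt⟩ := hclose
      have : ∃ p q, p < q ∧ cdist σ p q ≤ k + 2 := by
        rcases lt_or_gt_of_ne hij with h | h
        · exact ⟨i, j, h, by omega⟩
        · exact ⟨j, i, h, by rw [cdist_comm]; omega⟩
      obtain ⟨p, q, hpq, hle⟩ := this
      obtain ⟨s, π, hs, hpat, hnot⟩ := exists_not_isCylKing_of_cdist_le σ hn hpq hle
      exact hnot (hking s π hs hpat)
  · intro h
    exact ⟨fun s π _ hpat => isCylKing_of_isPatternOn (by omega) h hpat,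
      fun s t π _ _ hs ht => eq_of_isPatternOn (by omega) h hs ht⟩
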